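/- arXiv:2605.26407 — 6 statements merged into one kernel-verified Lean document; each statement's English description precedes it below -/
import Mathlib

section
/- Let p be a prime number and let r ≥ 1 and g ≥ 2 be integers. Define the natural number N = r·g − ⌊(g−1)/(p−1)⌋ + ⌊log_p(g−1)⌋ + 1 (with natural-number floor division and Nat.log). Then for every integer i with 1 ≤ i ≤ g one has r·i ≤ N + v_p((i−1)!), where v_p = padicValNat p is the p-adic valuation. -/
/-- The sum of the base-`b` digits of `m` is at most `b - 1` times the largest possible number of
digits of a number bounded by `n`. -/
theorem Nat.digits_sum_le_sub_one_mul_log {b m n : ℕ} (hb : 1 < b) (hmn : m ≤ n) :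
    (b.digits m).sum ≤ (b - 1) * (Nat.log b n + 1) := by
  rcases Nat.eq_zero_or_pos m with rfl | hm
  · simp
  · have hsum : (b.digits m).sum ≤ (b.digits m).length • (b - 1) :=
      List.sum_le_card_nsmul _ _ fun d hd => Nat.le_sub_one_of_lt (Nat.digits_lt_base hb hd)
    rw [Nat.length_digits b m hb hm.ne', smul_eq_mul, mul_comm] at hsum
    exact hsum.trans (Nat.mul_le_mul_left _ (Nat.succ_le_succ (Nat.log_mono_right hmn)))

/-- A lower bound for `padicValNat p m !` from Legendre's formula. -/
theorem le_sub_one_mul_padicValNat_factorial_add_log {p m n : ℕ} (hp : p.Prime) (hmn : m ≤ n) :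
    m ≤ (p - 1) * (padicValNat p m.factorial + Nat.log p n + 1) := by
  have : Fact p.Prime := ⟨hp⟩
  have hlegendre := sub_one_mul_padicValNat_factorial (p := p) m
  have hdigits := Nat.digits_sum_le_sub_one_mul_log hp.one_lt hmn
  rw [add_assoc, mul_add]
  omega

theorem stmt_1 (p : ℕ) (hp : p.Prime) (r g : ℕ) (hr : 1 ≤ r) (hg : 2 ≤ g) :
    ∀ i : ℕ, 1 ≤ i → i ≤ g →
      r * i ≤ (r * g - (g - 1) / (p - 1) + Nat.log p (g - 1) + 1) +
        padicValNat p (Nat.factorial (i - 1)) := by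
  intro i hi hig
  have hm := le_sub_one_mul_padicValNat_factorial_add_log hp (Nat.sub_le_sub_right hig 1)
  obtain ⟨d, rfl⟩ := Nat.exists_eq_add_of_le hig
  have hd : d ≤ (p - 1) * (r * d) := by
    have hpr : 1 ≤ (p - 1) * r := Nat.mul_pos (Nat.sub_pos_of_lt hp.one_lt) hr
    rw [← mul_assoc]
    exact Nat.le_mul_of_pos_left d hpr
  have hdiv : (i + d - 1) / (p - 1) ≤
      padicValNat p (i - 1).factorial + Nat.log p (i + d - 1) + 1 + r * d := by
    apply Nat.div_le_of_le_mul
    rw [mul_add]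
    omega
  rw [mul_add]
  omega
end

section
/- Let R be a commutative ring, let M be an R-module, and let b be an element of the degree-2 part of the exterior algebra of M, i.e. b lies in the square (range ι)^2 of the submodule range ι ⊆ ExteriorAlgebra R M, where ι : M → ExteriorAlgebra R M is the canonical inclusion. Then for every natural number i there exists an element a of the submodule (range ι)^(2i) such that b^i = i! • a. -/
open ExteriorAlgebra

namespace ExteriorAlgebra

variable {R : Type*} [CommRing R] {M : Type*} [AddCommGroup M] [Module R M]

theorem ι_mul_swap (x y : M) : ι R x * ι R y = -(ι R y * ι R x) :=
  eq_neg_of_add_eq_zero_left (ι_add_mul_swap x y)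

theorem commute_ι_mul_ι (x y : M) (z : ExteriorAlgebra R M) : Commute (ι R x * ι R y) z := by
  induction z using ExteriorAlgebra.induction with
  | algebraMap r => exact Algebra.commute_algebraMap_right r _
  | ι w =>
    rw [Commute, SemiconjBy, mul_assoc, ι_mul_swap y w, mul_neg, ← mul_assoc, ι_mul_swap x w,
      neg_mul, neg_neg, mul_assoc]
  | mul a b ha hb => exact ha.mul_right hb
  | add a b ha hb => exact ha.add_right hb

theorem ι_mul_ι_sq (x y : M) : (ι R x * ι R y) ^ 2 = 0 := by
  rw [sq, ← mul_assoc, (commute_ι_mul_ι x y (ι R x)).eq, ← mul_assoc, ι_sq_zero, zero_mul,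
    zero_mul]

theorem commute_of_mem_range_ι_sq {b : ExteriorAlgebra R M}
    (hb : b ∈ LinearMap.range (ι R : M →ₗ[R] ExteriorAlgebra R M) ^ 2)
    (z : ExteriorAlgebra R M) : Commute b z := by
  rw [sq] at hb
  induction hb using Submodule.mul_induction_on' with
  | mem_mul_mem m hm n hn =>
    obtain ⟨x, rfl⟩ := hm
    obtain ⟨y, rfl⟩ := hn
    exact commute_ι_mul_ι x y z
  | add x _ y _ hx hy => exact hx.add_left hy

end ExteriorAlgebra

/-- Divided powers of commuting elements add up to divided powers of the sum. -/
theorem Commute.exists_add_pow_eq_factorial_smul {R A : Type*} [CommSemiring R] [Semiring A]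
    [Algebra R A] {N : Submodule R A} {k : ℕ} {x y : A} (h : Commute x y)
    (hx : ∀ i : ℕ, ∃ a ∈ N ^ (k * i), x ^ i = i.factorial • a)
    (hy : ∀ i : ℕ, ∃ a ∈ N ^ (k * i), y ^ i = i.factorial • a) (i : ℕ) :
    ∃ a ∈ N ^ (k * i), (x + y) ^ i = i.factorial • a := by
  choose f hf hxf using hx
  choose g hg hyg using hy
  refine ⟨∑ m ∈ Finset.HasAntidiagonal.antidiagonal i, f m.1 * g m.2,
    Submodule.sum_mem _ fun m hm ↦ ?_, ?_⟩
  · rw [← Finset.HasAntidiagonal.mem_antidiagonal.1 hm, mul_add, pow_add]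
    exact Submodule.mul_mem_mul (hf _) (hg _)
  · rw [h.add_pow', Finset.smul_sum]
    refine Finset.sum_congr rfl fun m hm ↦ ?_
    rw [hxf, hyg, smul_mul_smul_comm, smul_smul, ← Finset.HasAntidiagonal.mem_antidiagonal.1 hm,
      ← mul_assoc, Nat.choose_symm_add, Nat.add_choose_mul_factorial_mul_factorial]

theorem stmt_3 (R : Type*) [CommRing R] (M : Type*) [AddCommGroup M] [Module R M]
    (b : ExteriorAlgebra R M)
    (hb : b ∈ (LinearMap.range (ι R : M →ₗ[R] ExteriorAlgebra R M)) ^ 2) :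
    ∀ i : ℕ, ∃ a ∈ (LinearMap.range (ι R : M →ₗ[R] ExteriorAlgebra R M)) ^ (2 * i),
      b ^ i = Nat.factorial i • a := by
  rw [sq] at hb
  induction hb using Submodule.mul_induction_on' with
  | mem_mul_mem m hm n hn =>
    intro i
    have hmem : m * n ∈ LinearMap.range (ι R : M →ₗ[R] ExteriorAlgebra R M) ^ 2 :=
      sq (LinearMap.range (ι R : M →ₗ[R] ExteriorAlgebra R M)) ▸ Submodule.mul_mem_mul hm hn
    obtain ⟨x, rfl⟩ := hm
    obtain ⟨y, rfl⟩ := hn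
    obtain hi | hi := lt_or_ge i 2
    · refine ⟨_, (pow_mul (LinearMap.range (ι R : M →ₗ[R] ExteriorAlgebra R M)) 2 i).symm ▸
        Submodule.pow_mem_pow _ hmem i, ?_⟩
      rw [Nat.factorial_eq_one.2 (Nat.lt_succ_iff.1 hi), one_smul]
    · exact ⟨0, zero_mem _, by rw [pow_eq_zero_of_le hi (ι_mul_ι_sq x y), smul_zero]⟩
  | add x hx y _ ihx ihy =>
    rw [← sq] at hx
    exact (commute_of_mem_range_ι_sq hx y).exists_add_pow_eq_factorial_smul ihx ihy
end

section
/- Let p be a prime, let r ≥ 1 and g ≥ 2 be integers, and define N = r·g − ⌊(g−1)/(p−1)⌋ + ⌊log_p(g−1)⌋ + 1 (natural-number floor division and Nat.log). Let M be a ℤ-module and let b be an element of the submodule (range ι)^2 of ExteriorAlgebra ℤ M, where ι is the canonical inclusion of M. Then for every integer i with 1 ≤ i ≤ g there exists an element a of the submodule (range ι)^(2i) such that (p^N choose i) • b^i = p^(r·i) • a. -/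
open ExteriorAlgebra

namespace ExteriorAlgebra

variable {R M : Type*} [CommRing R] [AddCommGroup M] [Module R M]

/-- Elements of degree two commute with vectors. -/
theorem commute_ι_of_mem_range_sq {b : ExteriorAlgebra R M}
    (hb : b ∈ (LinearMap.range (ι R : M →ₗ[R] ExteriorAlgebra R M)) ^ 2) (z : M) :
    Commute b (ι R z) := by
  rw [pow_two] at hb
  induction hb using Submodule.mul_induction_on' with
  | mem_mul_mem _ hx _ hy =>
    obtain ⟨x, rfl⟩ := hx
    obtain ⟨y, rfl⟩ := hy
    have swap (u v : M) : ι R u * ι R v = -(ι R v * ι R u) :=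
      eq_neg_of_add_eq_zero_left (ι_add_mul_swap u v)
    rw [commute_iff_eq, mul_assoc, swap y z, mul_neg, ← mul_assoc, swap x z, neg_mul, neg_neg,
      mul_assoc]
  | add _ _ _ _ h₁ h₂ => exact h₁.add_left h₂

/-- Elements of degree two commute with each other. -/
theorem commute_of_mem_range_sq {b c : ExteriorAlgebra R M}
    (hb : b ∈ (LinearMap.range (ι R : M →ₗ[R] ExteriorAlgebra R M)) ^ 2)
    (hc : c ∈ (LinearMap.range (ι R : M →ₗ[R] ExteriorAlgebra R M)) ^ 2) :
    Commute b c := by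
  rw [pow_two] at hc
  induction hc using Submodule.mul_induction_on' with
  | mem_mul_mem _ hx _ hy =>
    obtain ⟨x, rfl⟩ := hx
    obtain ⟨y, rfl⟩ := hy
    exact (commute_ι_of_mem_range_sq hb x).mul_right (commute_ι_of_mem_range_sq hb y)
  | add _ _ _ _ h₁ h₂ => exact h₁.add_right h₂

/-- Elements of degree two have divided powers. -/
theorem exists_pow_eq_factorial_smul {b : ExteriorAlgebra R M}
    (hb : b ∈ (LinearMap.range (ι R : M →ₗ[R] ExteriorAlgebra R M)) ^ 2) (n : ℕ) :
    ∃ c ∈ (LinearMap.range (ι R : M →ₗ[R] ExteriorAlgebra R M)) ^ (2 * n),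
      b ^ n = n.factorial • c := by
  rw [pow_two] at hb
  induction hb using Submodule.mul_induction_on' generalizing n with
  | mem_mul_mem x hx y hy =>
    have hxy : x * y ∈ (LinearMap.range (ι R : M →ₗ[R] ExteriorAlgebra R M)) ^ 2 := by
      rw [pow_two]
      exact Submodule.mul_mem_mul hx hy
    match n with
    | 0 => exact ⟨1, by simp [Submodule.one_le.mp le_rfl], by simp⟩
    | 1 => exact ⟨x * y, by simpa using hxy, by simp⟩
    | n + 2 =>
      refine ⟨0, zero_mem _, ?_⟩
      obtain ⟨x, rfl⟩ := hx
      have hsq : (ι R x * y) ^ 2 = 0 := by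
        rw [pow_two, ← mul_assoc, (commute_ι_of_mem_range_sq hxy x).eq, ← mul_assoc, ι_sq_zero,
          zero_mul, zero_mul]
      rw [pow_add, hsq, mul_zero, smul_zero]
  | add x hx y hy ihx ihy =>
    rw [← pow_two] at hx hy
    choose c hc hxc using ihx
    choose d hd hyd using ihy
    refine ⟨∑ m ∈ Finset.range (n + 1), c m * d (n - m), Submodule.sum_mem _ fun m hm => ?_, ?_⟩
    · have hmn : 2 * n = 2 * m + 2 * (n - m) := by
        have := Finset.mem_range.mp hm
        omega
      rw [hmn, pow_add]
      exact Submodule.mul_mem_mul (hc m) (hd (n - m))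
    · rw [(commute_of_mem_range_sq hx hy).add_pow, Finset.smul_sum]
      refine Finset.sum_congr rfl fun m hm => ?_
      have hmn : m ≤ n := Nat.lt_succ_iff.mp (Finset.mem_range.mp hm)
      rw [hxc, hyd, ← Nat.choose_mul_factorial_mul_factorial hmn, smul_mul_smul_comm,
        ← Nat.cast_comm, ← nsmul_eq_mul, smul_smul, mul_assoc]

end ExteriorAlgebra

/-- A lower bound for the `p`-adic valuation of a factorial, from Legendre's formula. -/
theorem Nat.Prime.div_sub_one_le_padicValNat_factorial {p : ℕ} (hp : p.Prime) (n : ℕ) :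
    n / (p - 1) ≤ padicValNat p n.factorial + Nat.log p n + 1 := by
  have : Fact p.Prime := ⟨hp⟩
  rcases Nat.eq_zero_or_pos n with rfl | hn
  · simp
  have hlegendre := sub_one_mul_padicValNat_factorial (p := p) n
  have hsum : (p.digits n).sum ≤ (p.digits n).length • (p - 1) :=
    List.sum_le_card_nsmul _ _ fun d hd =>
      Nat.le_sub_one_of_lt (Nat.digits_lt_base hp.one_lt hd)
  rw [Nat.length_digits p n hp.one_lt hn.ne', smul_eq_mul] at hsum
  refine Nat.div_le_of_le_mul ?_
  calc n ≤ (p - 1) * padicValNat p n.factorial + (Nat.log p n + 1) * (p - 1) := by omega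
    _ = (p - 1) * (padicValNat p n.factorial + Nat.log p n + 1) := by ring

/-- Natural-number division does not increase distances. -/
theorem Nat.add_div_le_div_add (a d k : ℕ) : (a + d) / k ≤ a / k + d := by
  rcases Nat.eq_zero_or_pos k with rfl | hk
  · simp
  · calc (a + d) / k ≤ (a + k * d) / k :=
          Nat.div_le_div_right (Nat.add_le_add_left (Nat.le_mul_of_pos_left d hk) a)
      _ = a / k + d := Nat.add_mul_div_left a d hk

theorem Nat.mul_factorial_pred_dvd_choose_mul_factorial (n : ℕ) {i : ℕ} (hi : 1 ≤ i) :
    n * (i - 1).factorial ∣ n.choose i * i.factorial := by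
  obtain ⟨i, rfl⟩ := Nat.exists_eq_add_of_le' hi
  cases n with
  | zero => simp
  | succ n =>
    refine ⟨n.choose i, ?_⟩
    rw [Nat.factorial_succ, ← mul_assoc, ← Nat.add_one_mul_choose_eq, Nat.add_sub_cancel]
    ring

/-- The exponent `N` absorbs the denominators of all `i`-th divided powers with `i ≤ g`. -/
theorem Nat.Prime.pow_dvd_choose_mul_factorial {p : ℕ} (hp : p.Prime) {r g i : ℕ} (hr : 1 ≤ r)
    (hi : 1 ≤ i) (hig : i ≤ g) :
    p ^ (r * i) ∣ (p ^ (r * g - (g - 1) / (p - 1) + Nat.log p (g - 1) + 1)).choose i *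
      i.factorial := by
  refine dvd_trans ?_ (Nat.mul_factorial_pred_dvd_choose_mul_factorial _ hi)
  refine dvd_trans ?_ (Nat.mul_dvd_mul_left _ (pow_padicValNat_dvd (p := p)))
  rw [← pow_add]
  refine pow_dvd_pow p ?_
  have hval := hp.div_sub_one_le_padicValNat_factorial (i - 1)
  have hlog : Nat.log p (i - 1) ≤ Nat.log p (g - 1) := Nat.log_mono_right (by omega)
  have hdiv := Nat.add_div_le_div_add (i - 1) (g - i) (p - 1)
  rw [show i - 1 + (g - i) = g - 1 by omega] at hdiv
  have hrg : r * g = r * i + r * (g - i) := by rw [← mul_add, Nat.add_sub_cancel' hig]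
  have hmul : g - i ≤ r * (g - i) := Nat.le_mul_of_pos_left _ hr
  omega

theorem stmt_4 (p : ℕ) (hp : p.Prime) (r g : ℕ) (hr : 1 ≤ r) (hg : 2 ≤ g)
    (N : ℕ) (hN : N = r * g - (g - 1) / (p - 1) + Nat.log p (g - 1) + 1)
    (M : Type*) [AddCommGroup M]
    (b : ExteriorAlgebra ℤ M)
    (hb : b ∈ (LinearMap.range (ι ℤ : M →ₗ[ℤ] ExteriorAlgebra ℤ M)) ^ 2) :
    ∀ i : ℕ, 1 ≤ i → i ≤ g →
      ∃ a ∈ (LinearMap.range (ι ℤ : M →ₗ[ℤ] ExteriorAlgebra ℤ M)) ^ (2 * i),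
        Nat.choose (p ^ N) i • b ^ i = p ^ (r * i) • a := by
  intro i hi hig
  obtain ⟨c, hc, hbc⟩ := exists_pow_eq_factorial_smul hb i
  obtain ⟨k, hk⟩ := hp.pow_dvd_choose_mul_factorial hr hi hig
  exact ⟨k • c, nsmul_mem hc k, by rw [hbc, smul_smul, smul_smul, hN, hk]⟩
end

section
/- In the exterior algebra over ℤ of the free module ℤ⁸ = (Fin 8 → ℤ), with x₁,y₁,…,x₄,y₄ the images of the standard basis vectors, ωᵢ = xᵢ·yᵢ, θ = ω₁+ω₂+ω₃+ω₄, and b = x₁·(y₁+y₃) + x₂·y₂ + x₃·y₁: one has b·b·b·b = 0 and b·b·θ·θ = 0. -/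
noncomputable section

open ExteriorAlgebra

/-- The image of the `i`-th standard basis vector of `ℤ⁸` in the exterior algebra. -/
def e (i : Fin 8) : ExteriorAlgebra ℤ (Fin 8 → ℤ) :=
  ι ℤ (Pi.single i 1 : Fin 8 → ℤ)

def x₁ : ExteriorAlgebra ℤ (Fin 8 → ℤ) := e 0
def y₁ : ExteriorAlgebra ℤ (Fin 8 → ℤ) := e 1
def x₂ : ExteriorAlgebra ℤ (Fin 8 → ℤ) := e 2
def y₂ : ExteriorAlgebra ℤ (Fin 8 → ℤ) := e 3
def x₃ : ExteriorAlgebra ℤ (Fin 8 → ℤ) := e 4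
def y₃ : ExteriorAlgebra ℤ (Fin 8 → ℤ) := e 5
def x₄ : ExteriorAlgebra ℤ (Fin 8 → ℤ) := e 6
def y₄ : ExteriorAlgebra ℤ (Fin 8 → ℤ) := e 7

def ω₁ : ExteriorAlgebra ℤ (Fin 8 → ℤ) := x₁ * y₁
def ω₂ : ExteriorAlgebra ℤ (Fin 8 → ℤ) := x₂ * y₂
def ω₃ : ExteriorAlgebra ℤ (Fin 8 → ℤ) := x₃ * y₃
def ω₄ : ExteriorAlgebra ℤ (Fin 8 → ℤ) := x₄ * y₄

def θ : ExteriorAlgebra ℤ (Fin 8 → ℤ) := ω₁ + ω₂ + ω₃ + ω₄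

def b : ExteriorAlgebra ℤ (Fin 8 → ℤ) := x₁ * (y₁ + y₃) + x₂ * y₂ + x₃ * y₁

theorem e_mul_self (i : Fin 8) : e i * e i = 0 :=
  ι_sq_zero _

theorem e_mul_self_mul (i : Fin 8) (z : ExteriorAlgebra ℤ (Fin 8 → ℤ)) :
    e i * (e i * z) = 0 := by
  rw [← mul_assoc, e_mul_self, zero_mul]

/-- Stated for `j < i` only, so that as a rewrite rule it sorts monomials. -/
theorem e_mul_e_of_lt {i j : Fin 8} (_ : j < i) : e i * e j = -(e j * e i) :=
  eq_neg_of_add_eq_zero_left (ι_add_mul_swap _ _)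

theorem e_mul_e_mul_of_lt {i j : Fin 8} (h : j < i) (z : ExteriorAlgebra ℤ (Fin 8 → ℤ)) :
    e i * (e j * z) = -(e j * (e i * z)) := by
  rw [← mul_assoc, e_mul_e_of_lt h, neg_mul, mul_assoc]

theorem b_mul_b : b * b = 2 • (e 0 * (e 1 * (e 2 * e 3)) + e 0 * (e 2 * (e 3 * e 5)) -
    e 1 * (e 2 * (e 3 * e 4)) - e 0 * (e 1 * (e 4 * e 5))) := by
  simp +decide only [b, x₁, y₁, x₂, y₂, x₃, y₃, mul_add, add_mul, mul_assoc, e_mul_self,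
    e_mul_self_mul, e_mul_e_of_lt, e_mul_e_mul_of_lt, mul_neg, neg_mul, neg_neg, mul_zero, neg_zero]
  abel

theorem stmt_8 : b * b * b * b = 0 ∧ b * b * θ * θ = 0 := by
  constructor
  · rw [mul_assoc, b_mul_b, smul_mul_smul_comm]
    simp +decide only [mul_add, add_mul, mul_sub, sub_mul, mul_assoc, e_mul_self,
      e_mul_self_mul, e_mul_e_of_lt, e_mul_e_mul_of_lt, mul_neg, neg_neg, mul_zero, neg_zero,
      add_zero, sub_zero, smul_zero]
  · rw [b_mul_b, smul_mul_assoc, smul_mul_assoc]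
    simp +decide only [θ, ω₁, ω₂, ω₃, ω₄, x₁, y₁, x₂, y₂, x₃, y₃, x₄, y₄, mul_add,
      add_mul, sub_mul, mul_assoc, e_mul_self,
      e_mul_self_mul, e_mul_e_of_lt, e_mul_e_mul_of_lt, mul_neg, neg_neg, mul_zero, neg_zero]
    abel

end
end

section
/- In the exterior algebra over ℤ of the free module ℤ⁸ = (Fin 8 → ℤ), with x₁,y₁,…,x₄,y₄ the images of the standard basis vectors, ωᵢ = xᵢ·yᵢ, θ = ω₁+ω₂+ω₃+ω₄, and b = x₁·(y₁+y₃) + x₂·y₂ + x₃·y₁: one has b·θ·θ·θ = 12 • (ω₁·ω₂·ω₃·ω₄). -/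
noncomputable section

open ExteriorAlgebra

/-- Products `u * v` of two degree-one elements are central. -/
theorem ι_mul_ι_commute {R M : Type*} [CommRing R] [AddCommGroup M] [Module R M] (u v : M)
    (a : ExteriorAlgebra R M) :
    Commute (ι R u * ι R v) a := by
  induction a using ExteriorAlgebra.induction with
  | algebraMap r => exact (Algebra.commutes r _).symm
  | ι w =>
    have huw := eq_neg_of_add_eq_zero_left (ι_add_mul_swap (R := R) u w)
    have hvw := eq_neg_of_add_eq_zero_left (ι_add_mul_swap (R := R) v w)
    rw [Commute, SemiconjBy, mul_assoc, hvw, mul_neg, ← mul_assoc, huw, neg_mul, neg_neg, mul_assoc]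
  | mul a b ha hb => exact ha.mul_right hb
  | add a b ha hb => exact ha.add_right hb

/-- A product of two decomposable degree-two elements with the same left factor vanishes. -/
theorem ι_mul_ι_mul_left_self {R M : Type*} [CommRing R] [AddCommGroup M] [Module R M]
    (u v w : M) :
    ι R u * ι R v * (ι R u * ι R w) = 0 := by
  rw [← mul_assoc, (ι_mul_ι_commute u v (ι R u)).eq, ← mul_assoc, ι_sq_zero, zero_mul, zero_mul]

/-- A product of two decomposable degree-two elements with the same right factor vanishes. -/
theorem ι_mul_ι_mul_right_self {R M : Type*} [CommRing R] [AddCommGroup M] [Module R M]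
    (u v w : M) :
    ι R u * ι R v * (ι R w * ι R v) = 0 := by
  rw [← (ι_mul_ι_commute w v _).eq, mul_assoc, (ι_mul_ι_commute u v (ι R v)).symm.eq,
    mul_assoc, ι_sq_zero, mul_zero, mul_zero]

/-- If `p₁, …, p₄` are square-zero elements of a commutative ring and `c` is annihilated by
`p₁` and `p₃`, then `(p₁ + p₂ + c) (p₁ + p₂ + p₃ + p₄)³ = 12 p₁ p₂ p₃ p₄`. -/
theorem add_mul_sum_cube_of_sq_eq_zero {R : Type*} [CommRing R] {p₁ p₂ p₃ p₄ c : R}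
    (h₁ : p₁ * p₁ = 0) (h₂ : p₂ * p₂ = 0) (h₃ : p₃ * p₃ = 0) (h₄ : p₄ * p₄ = 0)
    (hc₁ : c * p₁ = 0) (hc₃ : c * p₃ = 0) :
    (p₁ + p₂ + c) * (p₁ + p₂ + p₃ + p₄) * (p₁ + p₂ + p₃ + p₄) * (p₁ + p₂ + p₃ + p₄) =
      (12 : ℤ) • (p₁ * p₂ * p₃ * p₄) := by
  rw [zsmul_eq_mul]
  push_cast
  grind

theorem stmt_10 : b * θ * θ * θ = (12 : ℤ) • (ω₁ * ω₂ * ω₃ * ω₄) := by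
  let x (i : Fin 8) : Fin 8 → ℤ := Pi.single i 1
  let Z := Subring.center (ExteriorAlgebra ℤ (Fin 8 → ℤ))
  let q (i j : Fin 8) : Z :=
    ⟨e i * e j, Subring.mem_center_iff.2 fun a => (ι_mul_ι_commute (x i) (x j) a).symm.eq⟩
  have hleft (i j k : Fin 8) : q i j * q i k = 0 :=
    Subtype.ext (ι_mul_ι_mul_left_self (x i) (x j) (x k))
  have hright (i j k : Fin 8) : q i j * q k j = 0 :=
    Subtype.ext (ι_mul_ι_mul_right_self (x i) (x j) (x k))
  have hb : b = ((q 0 1 + q 2 3 + (q 0 5 + q 4 1) : Z) : ExteriorAlgebra ℤ (Fin 8 → ℤ)) := by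
    simp only [b, x₁, y₁, x₂, y₂, x₃, y₃, q, Subring.coe_add, mul_add]
    abel
  rw [hb]
  exact congrArg Subtype.val (add_mul_sum_cube_of_sq_eq_zero
    (hleft 0 1 1) (hleft 2 3 3) (hleft 4 5 5) (hleft 6 7 7)
    (by rw [add_mul, hleft, hright, add_zero]) (by rw [add_mul, hleft, hright, add_zero]))

end
end

section
/- Let R be a commutative ring, M an R-module, g a natural number, and v, w : Fin g → M. In the exterior algebra ExteriorAlgebra R M, set sᵢ = ι(vᵢ)·ι(wᵢ) and θ = s₁ + ⋯ + s_g. Then for every natural number k, θ^k = k! • ( Σ over all subsets S of Fin g with |S| = k of the product ∏_{i ∈ S} sᵢ ), where the product over S is well-defined because the elements sᵢ pairwise commute. -/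
open ExteriorAlgebra

theorem Commute.add_pow_succ_of_sq_eq_zero {A : Type*} [Semiring A] {x y : A}
    (h : Commute x y) (hx : x * x = 0) (n : ℕ) :
    (x + y) ^ (n + 1) = y ^ (n + 1) + (n + 1) • (x * y ^ n) := by
  induction n with
  | zero => simp [add_comm]
  | succ n ih =>
    have hxy : x * y ^ n * x = 0 := by
      rw [mul_assoc, ← (h.pow_right n).eq, ← mul_assoc, hx, zero_mul]
    rw [pow_succ, ih, add_mul, mul_add, smul_mul_assoc, mul_add, hxy, zero_add,
      ← (h.pow_right (n + 1)).eq, mul_assoc, ← pow_succ, ← pow_succ, succ_nsmul _ (n + 1)]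
    abel

/-- Powers of a sum of pairwise commuting square-zero elements. -/
theorem Finset.sum_pow_of_commute_of_sq_eq_zero {A α : Type*} [Semiring A] [DecidableEq α]
    (f : α → A) (hc : Pairwise (Function.onFun Commute f)) (hf : ∀ i, f i * f i = 0)
    (s : Finset α) (k : ℕ) :
    (∑ i ∈ s, f i) ^ k =
      k.factorial • ∑ S ∈ s.powersetCard k, S.noncommProd f (hc.set_pairwise _) := by
  induction s using Finset.induction_on generalizing k with
  | empty =>
    cases k with
    | zero => simp
    | succ k =>
      rw [Finset.powersetCard_eq_empty.2 (by simp), Finset.sum_empty, Finset.sum_empty,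
        smul_zero, zero_pow k.succ_ne_zero]
  | insert a s ha ih =>
    cases k with
    | zero => simp
    | succ k =>
      have himage : ∑ S ∈ (s.powersetCard k).image (insert a),
            S.noncommProd f (hc.set_pairwise _) =
          f a * ∑ S ∈ s.powersetCard k, S.noncommProd f (hc.set_pairwise _) := by
        have hmem : ∀ S ∈ s.powersetCard k, a ∉ S := fun S hS haS =>
          ha ((Finset.mem_powersetCard.1 hS).1 haS)
        rw [Finset.sum_image, Finset.mul_sum]
        · exact Finset.sum_congr rfl fun S hS =>
            Finset.noncommProd_insert_of_notMem S a f _ (hmem S hS)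
        · intro S hS T hT hST
          rw [← Finset.erase_insert (hmem S hS), hST, Finset.erase_insert (hmem T hT)]
      have hdisj : Disjoint (s.powersetCard (k + 1)) ((s.powersetCard k).image (insert a)) := by
        rw [Finset.disjoint_left]
        intro S hS hS'
        obtain ⟨T, -, rfl⟩ := Finset.mem_image.1 hS'
        exact ha ((Finset.mem_powersetCard.1 hS).1 (Finset.mem_insert_self a T))
      rw [Finset.sum_insert ha,
        (Commute.sum_right s f (f a) fun j hj =>
          hc (ne_of_mem_of_not_mem hj ha).symm).add_pow_succ_of_sq_eq_zero (hf a),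
        Finset.powersetCard_succ_insert ha, Finset.sum_union hdisj, himage, ih, ih,
        mul_smul_comm, smul_smul, ← Nat.factorial_succ, smul_add]

theorem ExteriorAlgebra.ι_mul_ι_anticomm {R M : Type*} [CommRing R] [AddCommGroup M] [Module R M]
    (x y : M) : ι R x * ι R y = -(ι R y * ι R x) :=
  eq_neg_of_add_eq_zero_left (ι_add_mul_swap x y)

theorem ExteriorAlgebra.commute_ι_mul_ι_s11 {R M : Type*} [CommRing R] [AddCommGroup M] [Module R M]
    (x y z : M) : Commute (ι R x * ι R y) (ι R z) := by
  rw [Commute, SemiconjBy, mul_assoc, ι_mul_ι_anticomm y z, mul_neg, ← mul_assoc,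
    ι_mul_ι_anticomm x z, neg_mul, neg_neg, mul_assoc]

theorem stmt_11 (R : Type*) [CommRing R] (M : Type*) [AddCommGroup M] [Module R M]
    (g : ℕ) (v w : Fin g → M) :
    ∀ k : ℕ,
      (∑ i, ι R (v i) * ι R (w i)) ^ k =
        Nat.factorial k •
          ∑ S ∈ Finset.univ.powersetCard k,
            ((S.sort (· ≤ ·)).map (fun i => ι R (v i) * ι R (w i))).prod := by
  intro k
  have hc : ∀ i j, Commute (ι R (v i) * ι R (w i)) (ι R (v j) * ι R (w j)) := fun i j =>
    (commute_ι_mul_ι_s11 _ _ _).mul_right (commute_ι_mul_ι_s11 _ _ _)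
  have hsq : ∀ i, ι R (v i) * ι R (w i) * (ι R (v i) * ι R (w i)) = 0 := fun i => by
    rw [← mul_assoc, (commute_ι_mul_ι_s11 _ _ _).eq, ← mul_assoc, ι_sq_zero, zero_mul, zero_mul]
  rw [Finset.sum_pow_of_commute_of_sq_eq_zero _ (fun i j _ => hc i j) hsq]
  congr 1
  refine Finset.sum_congr rfl fun S _ => ?_
  rw [← Finset.noncommProd_toFinset (S.sort (· ≤ ·)) _ (fun i _ j _ _ => hc i j)
    (S.sort_nodup _)]
  exact Finset.noncommProd_congr (S.sort_toFinset _).symm (fun _ _ => rfl) _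
end
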